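/- arXiv:2406.12859 — 2 statements merged into one kernel-verified Lean document; each statement's English description precedes it below -/
import Mathlib

section
/- Let (L,T) be a Reynolds Lie–Yamaguti algebra of weight λ and (V;ρ,θ,T_V) a representation of it. Define ρ_T(x)u := ρ(Tx)u - T_V(λρ(Tx)u + ρ(x)u) and θ_T(x,y)u := θ(Tx,Ty)u - T_V(2λθ(Tx,Ty)u + θ(Tx,y)u + θ(x,Ty)u). Then (V;ρ_T,θ_T) is a representation of the Lie–Yamaguti algebra L_T = (L, [-,-]_T, {-,-,-}_T), where [x,y]_T := [Tx,y] + [x,Ty] + λ[Tx,Ty] and {x,y,z}_T := {x,Ty,Tz} + {Tx,y,Tz} + {Tx,Ty,z} + 2λ{Tx,Ty,Tz}. -/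
open Finset

variable (K : Type*) [Field K] [CharZero K]
variable {L : Type*} [AddCommGroup L] [Module K L]
variable {V : Type*} [AddCommGroup V] [Module K V]

/-- A Lie–Yamaguti algebra structure given by a bilinear bracket `br` and a
trilinear bracket `tr`, satisfying (LY1)–(LY6). -/
def IsLYAlgebra (br : L → L → L) (tr : L → L → L → L) : Prop :=
  (∀ y, IsLinearMap K fun x => br x y) ∧ (∀ x, IsLinearMap K (br x)) ∧
  (∀ y z, IsLinearMap K fun x => tr x y z) ∧ (∀ x z, IsLinearMap K fun y => tr x y z) ∧
  (∀ x y, IsLinearMap K (tr x y)) ∧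
  (∀ x y, br x y = - br y x) ∧
  (∀ x y z, tr x y z = - tr y x z) ∧
  (∀ x y z, br (br x y) z + br (br z x) y + br (br y z) x
      + tr x y z + tr z x y + tr y z x = 0) ∧
  (∀ x y z a, tr (br x y) z a + tr (br z x) y a + tr (br y z) x a = 0) ∧
  (∀ a b x y, tr a b (br x y) = br (tr a b x) y + br x (tr a b y)) ∧
  (∀ a b x y z, tr a b (tr x y z)
      = tr (tr a b x) y z + tr x (tr a b y) z + tr x y (tr a b z))

/-- `T` is a Reynolds operator of weight `lam` on the Lie–Yamaguti algebra `(L, br, tr)`. -/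
def IsReynoldsOp (lam : K) (br : L → L → L) (tr : L → L → L → L) (T : L → L) : Prop :=
  IsLinearMap K T ∧
  (∀ x y, br (T x) (T y) = T (br (T x) y + br x (T y) + lam • br (T x) (T y))) ∧
  (∀ x y z, tr (T x) (T y) (T z)
    = T (tr x (T y) (T z) + tr (T x) y (T z) + tr (T x) (T y) z
        + (2 * lam) • tr (T x) (T y) (T z)))

/-- The map `D(x,y) = θ(y,x) - θ(x,y) - ρ([x,y]) + ρ(x)ρ(y) - ρ(y)ρ(x)`. -/
def DMap (br : L → L → L) (rho : L → V → V) (theta : L → L → V → V)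
    (x y : L) (u : V) : V :=
  theta y x u - theta x y u - rho (br x y) u + rho x (rho y u) - rho y (rho x u)

/-- `(V; ρ, θ)` is a representation of the Lie–Yamaguti algebra `(L, br, tr)`. -/
def IsLYRep (br : L → L → L) (tr : L → L → L → L)
    (rho : L → V → V) (theta : L → L → V → V) : Prop :=
  (∀ u, IsLinearMap K fun x => rho x u) ∧ (∀ x, IsLinearMap K (rho x)) ∧
  (∀ y u, IsLinearMap K fun x => theta x y u) ∧
  (∀ x u, IsLinearMap K fun y => theta x y u) ∧
  (∀ x y, IsLinearMap K (theta x y)) ∧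
  (∀ x y a u, theta (br x y) a u = theta x a (rho y u) - theta y a (rho x u)) ∧
  (∀ a b x u, DMap br rho theta a b (rho x u)
      = rho x (DMap br rho theta a b u) + rho (tr a b x) u) ∧
  (∀ x a b u, theta x (br a b) u = rho a (theta x b u) - rho b (theta x a u)) ∧
  (∀ a b x y u, DMap br rho theta a b (theta x y u)
      = theta x y (DMap br rho theta a b u) + theta (tr a b x) y u + theta x (tr a b y) u) ∧
  (∀ a x y z u, theta a (tr x y z) u
      = theta y z (theta a x u) - theta x z (theta a y u)
        + DMap br rho theta x y (theta a z u))

/-- `(V; ρ, θ, T_V)` is a representation of the Reynolds Lie–Yamaguti algebra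
`(L, br, tr, T)` of weight `lam`. -/
def IsReynoldsRep (lam : K) (br : L → L → L) (tr : L → L → L → L) (T : L → L)
    (rho : L → V → V) (theta : L → L → V → V) (TV : V → V) : Prop :=
  IsLYRep K br tr rho theta ∧ IsLinearMap K TV ∧
  (∀ x u, rho (T x) (TV u)
      = TV (rho (T x) u + rho x (TV u) + lam • rho (T x) (TV u))) ∧
  (∀ x y u, theta (T x) (T y) (TV u)
      = TV (theta (T x) (T y) u + theta (T x) y (TV u) + theta x (T y) (TV u)
          + (2 * lam) • theta (T x) (T y) (TV u)))

/-- The deformed binary bracket `[x,y]_T`. -/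
def brT (lam : K) (br : L → L → L) (T : L → L) (x y : L) : L :=
  br (T x) y + br x (T y) + lam • br (T x) (T y)

/-- The deformed ternary bracket `{x,y,z}_T`. -/
def trT (lam : K) (tr : L → L → L → L) (T : L → L) (x y z : L) : L :=
  tr x (T y) (T z) + tr (T x) y (T z) + tr (T x) (T y) z
    + (2 * lam) • tr (T x) (T y) (T z)

/-- The deformed representation map `ρ_T`. -/
def rhoT (lam : K) (rho : L → V → V) (T : L → L) (TV : V → V) (x : L) (u : V) : V :=
  rho (T x) u - TV (lam • rho (T x) u + rho x u)

/-- The deformed representation map `θ_T`. -/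
def thetaT (lam : K) (theta : L → L → V → V) (T : L → L) (TV : V → V)
    (x y : L) (u : V) : V :=
  theta (T x) (T y) u
    - TV ((2 * lam) • theta (T x) (T y) u + theta (T x) y u + theta x (T y) u)

/-- The deformed map `D_T`. -/
def DT (lam : K) (br : L → L → L) (rho : L → V → V) (theta : L → L → V → V)
    (T : L → L) (TV : V → V) (x y : L) (u : V) : V :=
  DMap br rho theta (T x) (T y) u
    - TV ((2 * lam) • DMap br rho theta (T x) (T y) u
        + DMap br rho theta x (T y) u + DMap br rho theta (T x) y u)

section ReynoldsRep

omit [CharZero K]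

variable {K}
variable {lam : K} {br : L → L → L} {tr : L → L → L → L} {T : L → L}
  {rho : L → V → V} {theta : L → L → V → V} {TV : V → V}

/-- `ρ_T` intertwines `T_V` with `ρ ∘ T`. -/
theorem rhoT_TV (h : IsReynoldsRep K lam br tr T rho theta TV) (x : L) (u : V) :
    rhoT K lam rho T TV x (TV u) = TV (rho (T x) u) := by
  obtain ⟨-, hTV, hρ, -⟩ := h
  nth_rewrite 1 [rhoT, hρ]
  rw [← hTV.map_sub]
  congr 1
  module

/-- `θ_T` intertwines `T_V` with `θ ∘ (T × T)`. -/
theorem thetaT_TV (h : IsReynoldsRep K lam br tr T rho theta TV) (x y : L) (u : V) :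
    thetaT K lam theta T TV x y (TV u) = TV (theta (T x) (T y) u) := by
  obtain ⟨-, hTV, -, hθ⟩ := h
  nth_rewrite 1 [thetaT, hθ]
  rw [← hTV.map_sub]
  congr 1
  module

theorem isLinearMap_rhoT (h : IsReynoldsRep K lam br tr T rho theta TV) (x : L) :
    IsLinearMap K (rhoT K lam rho T TV x) := by
  obtain ⟨⟨-, hρ, -⟩, hTV, -⟩ := h
  constructor <;> intros <;>
    simp only [rhoT, (hρ _).map_add, (hρ _).map_smul, hTV.map_add, hTV.map_smul] <;> module

theorem isLinearMap_thetaT (h : IsReynoldsRep K lam br tr T rho theta TV) (x y : L) :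
    IsLinearMap K (thetaT K lam theta T TV x y) := by
  obtain ⟨⟨-, -, -, -, hθ, -⟩, hTV, -⟩ := h
  constructor <;> intros <;>
    simp only [thetaT, (hθ _ _).map_add, (hθ _ _).map_smul, hTV.map_add, hTV.map_smul] <;> module

theorem isLinearMap_DMap (h : IsLYRep K br tr rho theta) (x y : L) :
    IsLinearMap K (DMap br rho theta x y) := by
  obtain ⟨-, hρ, -, -, hθ, -⟩ := h
  constructor <;> intros <;>
    simp only [DMap, (hθ _ _).map_add, (hθ _ _).map_smul, (hρ _).map_add, (hρ _).map_smul] <;>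
    module

/-- The map `D` of the deformed representation is `D_T`. -/
theorem DMap_rhoT_thetaT (hT : IsReynoldsOp K lam br tr T)
    (h : IsReynoldsRep K lam br tr T rho theta TV) (x y : L) (u : V) :
    DMap (brT K lam br T) (rhoT K lam rho T TV) (thetaT K lam theta T TV) x y u
      = DT K lam br rho theta T TV x y u := by
  have hcomp (x y : L) (u : V) : rhoT K lam rho T TV x (rhoT K lam rho T TV y u)
      = rhoT K lam rho T TV x (rho (T y) u)
        - TV (rho (T x) (lam • rho (T y) u + rho y u)) := by
    rw [rhoT.eq_def K lam rho T TV y, (isLinearMap_rhoT h x).map_sub, rhoT_TV h]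
  have hbr : T (brT K lam br T x y) = br (T x) (T y) := (hT.2.1 x y).symm
  obtain ⟨⟨hρ₁, hρ, -⟩, hTV, -⟩ := h
  rw [DMap, hcomp, hcomp]
  simp only [rhoT, thetaT, DT, DMap, hbr]
  simp only [brT, (hρ₁ _).map_add, (hρ₁ _).map_smul, (hρ _).map_add, (hρ _).map_smul,
    hTV.map_add, hTV.map_sub, hTV.map_smul]
  module

/-- `D_T` intertwines `T_V` with `D ∘ (T × T)`. -/
theorem DT_TV (hT : IsReynoldsOp K lam br tr T)
    (h : IsReynoldsRep K lam br tr T rho theta TV) (x y : L) (u : V) :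
    DT K lam br rho theta T TV x y (TV u) = TV (DMap br rho theta (T x) (T y) u) := by
  have hbr : T (brT K lam br T x y) = br (T x) (T y) := (hT.2.1 x y).symm
  have hTV := h.2.1
  rw [← DMap_rhoT_thetaT hT h]
  simp only [DMap, rhoT_TV h, thetaT_TV h, hbr, hTV.map_add, hTV.map_sub]

theorem isLinearMap_DT (h : IsReynoldsRep K lam br tr T rho theta TV) (x y : L) :
    IsLinearMap K (DT K lam br rho theta T TV x y) := by
  have hD := isLinearMap_DMap h.1
  have hTV := h.2.1
  constructor <;> intros <;>
    simp only [DT, (hD _ _).map_add, (hD _ _).map_smul, hTV.map_add, hTV.map_smul] <;> module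

end ReynoldsRep

/-- `(V; ρ_T, θ_T)` is a representation of the descendent
Lie–Yamaguti algebra `L_T`. -/
theorem stmt3 (lam : K) (br : L → L → L) (tr : L → L → L → L) (T : L → L)
    (rho : L → V → V) (theta : L → L → V → V) (TV : V → V)
    (hLY : IsLYAlgebra K br tr) (hT : IsReynoldsOp K lam br tr T)
    (hrep : IsReynoldsRep K lam br tr T rho theta TV) :
    IsLYRep K (brT K lam br T) (trT K lam tr T)
      (rhoT K lam rho T TV) (thetaT K lam theta T TV) := by
  have hbr (x y : L) : T (brT K lam br T x y) = br (T x) (T y) := (hT.2.1 x y).symm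
  have htr (x y z : L) : T (trT K lam tr T x y z) = tr (T x) (T y) (T z) := (hT.2.2 x y z).symm
  have hTl := hT.1
  have hρT := isLinearMap_rhoT hrep
  have hθT := isLinearMap_thetaT hrep
  have hDT := isLinearMap_DT hrep
  have hD := isLinearMap_DMap hrep.1
  have hρTV := rhoT_TV hrep
  have hθTV := thetaT_TV hrep
  have hDTV := DT_TV hT hrep
  have hDeq := DMap_rhoT_thetaT hT hrep
  obtain ⟨⟨hρ₁, hρ, hθ₁, hθ₂, hθ, h₁, h₂, h₃, h₄, h₅⟩, hTV, -⟩ := hrep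
  have hρdef := rhoT.eq_def K lam rho T TV
  have hθdef := thetaT.eq_def K lam theta T TV
  have hDdef := DT.eq_def K lam br rho theta T TV
  refine ⟨fun u => ?_, hρT, fun y u => ?_, fun x u => ?_, hθT, fun x y a u => ?_,
    fun a b x u => ?_, fun x a b u => ?_, fun a b x y u => ?_, fun a x y z u => ?_⟩
  · constructor <;> intros <;>
      simp only [rhoT, hTl.map_add, hTl.map_smul, (hρ₁ _).map_add, (hρ₁ _).map_smul,
        hTV.map_add, hTV.map_smul] <;> module
  · constructor <;> intros <;>
      simp only [thetaT, hTl.map_add, hTl.map_smul, (hθ₁ _ _).map_add, (hθ₁ _ _).map_smul,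
        hTV.map_add, hTV.map_smul] <;> module
  · constructor <;> intros <;>
      simp only [thetaT, hTl.map_add, hTl.map_smul, (hθ₂ _ _).map_add, (hθ₂ _ _).map_smul,
        hTV.map_add, hTV.map_smul] <;> module
  · rw [hρdef y, hρdef x, (hθT _ _).map_sub, (hθT _ _).map_sub, hθTV, hθTV]
    simp only [thetaT, hbr]
    simp only [brT, (hθ₁ _ _).map_add, (hθ₁ _ _).map_smul, (hθ _ _).map_add, (hθ _ _).map_smul,
      h₁, hTV.map_add, hTV.map_sub, hTV.map_smul]
    module
  · rw [hDeq, hDeq, hρdef x u, hDdef a b u, (hDT _ _).map_sub, (hρT _).map_sub, hDTV, hρTV]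
    simp only [rhoT, DT, htr]
    simp only [trT, (hρ₁ _).map_add, (hρ₁ _).map_smul, (hρ _).map_add, (hρ _).map_smul,
      (hD _ _).map_add, (hD _ _).map_smul, h₂, hTV.map_add, hTV.map_smul]
    module
  · rw [hθdef x b, hθdef x a, (hρT _).map_sub, (hρT _).map_sub, hρTV, hρTV]
    simp only [rhoT, thetaT, hbr]
    simp only [brT, (hθ₂ _ _).map_add, (hθ₂ _ _).map_smul, (hρ _).map_add, (hρ _).map_smul,
      h₃, hTV.map_add, hTV.map_sub, hTV.map_smul]
    module
  · rw [hDeq, hDeq, hθdef x y u, hDdef a b u, (hDT _ _).map_sub, (hθT _ _).map_sub, hDTV, hθTV]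
    simp only [thetaT, DT, htr]
    simp only [trT, (hθ₁ _ _).map_add, (hθ₁ _ _).map_smul, (hθ₂ _ _).map_add, (hθ₂ _ _).map_smul,
      (hθ _ _).map_add, (hθ _ _).map_smul, (hD _ _).map_add, (hD _ _).map_smul, h₄,
      hTV.map_add, hTV.map_smul]
    module
  · rw [hDeq, hθdef a x, hθdef a y, hθdef a z, (hDT _ _).map_sub, (hθT _ _).map_sub,
      (hθT _ _).map_sub, hDTV, hθTV, hθTV]
    simp only [thetaT, DT, htr]
    simp only [trT, (hθ₂ _ _).map_add, (hθ₂ _ _).map_smul, (hθ _ _).map_add, (hθ _ _).map_smul,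
      (hD _ _).map_add, (hD _ _).map_smul, h₅, hTV.map_add, hTV.map_sub, hTV.map_smul]
    module
end

section
/- Let (L,T) be a Reynolds Lie–Yamaguti algebra of weight λ and (V;ρ,θ,T_V) a representation of it, with D(x,y) := θ(y,x) - θ(x,y) - ρ([x,y]) + ρ(x)ρ(y) - ρ(y)ρ(x), ρ_T(x)u := ρ(Tx)u - T_V(λρ(Tx)u + ρ(x)u), θ_T(x,y)u := θ(Tx,Ty)u - T_V(2λθ(Tx,Ty)u + θ(Tx,y)u + θ(x,Ty)u), D_T(x,y)u := D(Tx,Ty)u - T_V(2λD(Tx,Ty)u + D(x,Ty)u + D(Tx,y)u), [x,y]_T := [Tx,y] + [x,Ty] + λ[Tx,Ty] and {x,y,z}_T := {x,Ty,Tz} + {Tx,y,Tz} + {Tx,Ty,z} + 2λ{Tx,Ty,Tz}. For a linear map f : L → V define (δ¹_I f)(x,y) := ρ(x)f(y) - ρ(y)f(x) - f([x,y]) and (δ¹_II f)(x,y,z) := D(x,y)f(z) + θ(y,z)f(x) - θ(x,z)f(y) - f({x,y,z}); define Φ¹f := f∘T - T_V∘f; for a bilinear map g : L × L → V define (Φ²_I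 g)(x,y) := g(Tx,Ty) - T_V(g(x,Ty) + g(Tx,y) + λg(Tx,Ty)); for a trilinear map h : L × L × L → V define (Φ²_II h)(x,y,z) := h(Tx,Ty,Tz) - T_V(h(x,Ty,Tz) + h(Tx,y,Tz) + h(Tx,Ty,z) + 2λh(Tx,Ty,Tz)); and for a linear map k : L → V define (∂¹_I k)(x,y) := ρ_T(x)k(y) - ρ_T(y)k(x) - k([x,y]_T) and (∂¹_II k)(x,y,z) := D_T(x,y)k(z) + θ_T(y,z)k(x) - θ_T(x,z)k(y) - k({x,y,z}_T). Then for every linear map f : L → V one has Φ²_I(δ¹_I f) = ∂¹_I(Φ¹ f) and Φ²_II(δ¹_II f) = ∂¹_II(Φ¹ f). -/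
open Finset

variable (K : Type*) [Field K] [CharZero K]
variable {L : Type*} [AddCommGroup L] [Module K L]
variable {V : Type*} [AddCommGroup V] [Module K V]

/-- The first coboundary `δ¹_I` of the Lie–Yamaguti cochain complex. -/
def delta1I (br : L → L → L) (rho : L → V → V) (f : L → V) (x y : L) : V :=
  rho x (f y) - rho y (f x) - f (br x y)

/-- The first coboundary `δ¹_II` of the Lie–Yamaguti cochain complex. -/
def delta1II (br : L → L → L) (tr : L → L → L → L) (rho : L → V → V)
    (theta : L → L → V → V) (f : L → V) (x y z : L) : V :=
  DMap br rho theta x y (f z) + theta y z (f x) - theta x z (f y) - f (tr x y z)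

/-- The chain map `Φ¹` in degree 1. -/
def Phi1 (T : L → L) (TV : V → V) (f : L → V) (x : L) : V := f (T x) - TV (f x)

/-- The binary part `Φ²_I` of the chain map in degree 2. -/
def Phi2I (lam : K) (T : L → L) (TV : V → V) (g : L → L → V) (x y : L) : V :=
  g (T x) (T y) - TV (g x (T y) + g (T x) y + lam • g (T x) (T y))

/-- The ternary part `Φ²_II` of the chain map in degree 2. -/
def Phi2II (lam : K) (T : L → L) (TV : V → V) (h : L → L → L → V) (x y z : L) : V :=
  h (T x) (T y) (T z)
    - TV (h x (T y) (T z) + h (T x) y (T z) + h (T x) (T y) z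
        + (2 * lam) • h (T x) (T y) (T z))

/-- The first coboundary `∂¹_I` of the Reynolds operator cochain complex. -/
def partial1I (lam : K) (br : L → L → L) (rho : L → V → V) (T : L → L) (TV : V → V)
    (k : L → V) (x y : L) : V :=
  rhoT K lam rho T TV x (k y) - rhoT K lam rho T TV y (k x) - k (brT K lam br T x y)

/-- The first coboundary `∂¹_II` of the Reynolds operator cochain complex. -/
def partial1II (lam : K) (br : L → L → L) (tr : L → L → L → L)
    (rho : L → V → V) (theta : L → L → V → V) (T : L → L) (TV : V → V)
    (k : L → V) (x y z : L) : V :=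
  DT K lam br rho theta T TV x y (k z) + thetaT K lam theta T TV y z (k x)
    - thetaT K lam theta T TV x z (k y) - k (trT K lam tr T x y z)

/-- `DMap x y` preserves subtraction in its last argument. -/
theorem DMap_sub {K L V : Type*} [Field K] [AddCommGroup L] [Module K L]
    [AddCommGroup V] [Module K V] {br : L → L → L} {tr : L → L → L → L}
    {rho : L → V → V} {theta : L → L → V → V} (h : IsLYRep K br tr rho theta) (x y : L) (u v : V) :
    DMap br rho theta x y (u - v) = DMap br rho theta x y u - DMap br rho theta x y v := by
  obtain ⟨-, hrho, -, -, htheta, -⟩ := h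
  simp only [DMap, (hrho _).map_sub, (htheta _ _).map_sub]
  abel

/-- The map `D` of a representation of a Reynolds Lie–Yamaguti algebra satisfies the same
compatibility condition with the Reynolds operators as `θ`. -/
theorem DMap_reynolds {K L V : Type*} [Field K] [AddCommGroup L] [Module K L]
    [AddCommGroup V] [Module K V]
    {lam : K} {br : L → L → L} {tr : L → L → L → L} {T : L → L}
    {rho : L → V → V} {theta : L → L → V → V} {TV : V → V}
    (hT : IsReynoldsOp K lam br tr T) (hrep : IsReynoldsRep K lam br tr T rho theta TV)
    (x y : L) (u : V) :
    DMap br rho theta (T x) (T y) (TV u)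
      = TV (DMap br rho theta (T x) (T y) u + DMap br rho theta (T x) y (TV u)
          + DMap br rho theta x (T y) (TV u)
          + (2 * lam) • DMap br rho theta (T x) (T y) (TV u)) := by
  obtain ⟨-, hTbr, -⟩ := hT
  obtain ⟨⟨hrhoL, hrho, -⟩, hTV, hTVrho, hTVtheta⟩ := hrep
  have rho_br : rho (br (T x) (T y)) (TV u)
      = TV (rho (br (T x) (T y)) u + rho (br (T x) y) (TV u) + rho (br x (T y)) (TV u)
          + (2 * lam) • rho (br (T x) (T y)) (TV u)) := by
    have h := hTVrho (br (T x) y + br x (T y) + lam • br (T x) (T y)) u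
    rw [← hTbr, (hrhoL _).map_add, (hrhoL _).map_add, (hrhoL _).map_smul] at h
    refine h.trans (congrArg TV ?_)
    module
  have rho_rho (a b : L) : rho (T a) (rho (T b) (TV u))
      = TV (rho (T a) (rho (T b) u) + rho (T a) (rho b (TV u)) + rho a (rho (T b) (TV u))
          + (2 * lam) • rho (T a) (rho (T b) (TV u))) := by
    have h := hTVrho a (rho (T b) u + rho b (TV u) + lam • rho (T b) (TV u))
    rw [← hTVrho b, (hrho _).map_add, (hrho _).map_add, (hrho _).map_smul] at h
    refine h.trans (congrArg TV ?_)
    module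
  have theta_yx := hTVtheta y x u
  have theta_xy := hTVtheta x y u
  have rho_xy := rho_rho x y
  have rho_yx := rho_rho y x
  simp only [DMap, hTV.map_add, hTV.map_sub, hTV.map_smul]
    at theta_yx theta_xy rho_br rho_xy rho_yx ⊢
  linear_combination (norm := module) theta_yx - theta_xy - rho_br + rho_xy - rho_yx

/-- `Φ` is a chain map in lowest degree:
`Φ²_I ∘ δ¹_I = ∂¹_I ∘ Φ¹` and `Φ²_II ∘ δ¹_II = ∂¹_II ∘ Φ¹`. -/
theorem stmt5 (lam : K) (br : L → L → L) (tr : L → L → L → L) (T : L → L)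
    (rho : L → V → V) (theta : L → L → V → V) (TV : V → V)
    (hLY : IsLYAlgebra K br tr) (hT : IsReynoldsOp K lam br tr T)
    (hrep : IsReynoldsRep K lam br tr T rho theta TV) :
    ∀ f : L → V, IsLinearMap K f →
      (∀ x y, Phi2I K lam T TV (delta1I br rho f) x y
          = partial1I K lam br rho T TV (Phi1 T TV f) x y) ∧
      (∀ x y z, Phi2II K lam T TV (delta1II br tr rho theta f) x y z
          = partial1II K lam br tr rho theta T TV (Phi1 T TV f) x y z) := by
  have ⟨_, hTbr, hTtr⟩ := hT
  have ⟨hLYrep, hTV, hTVrho, hTVtheta⟩ := hrep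
  have ⟨_, hrho, _, _, htheta, _⟩ := hLYrep
  intro f hf
  refine ⟨fun x y => ?_, fun x y z => ?_⟩
  · simp only [Phi2I, delta1I, partial1I, rhoT, Phi1, brT, (hrho _).map_sub]
    rw [← hTbr]
    have rho_x := hTVrho x (f y)
    have rho_y := hTVrho y (f x)
    simp only [hf.map_add, hf.map_smul, hTV.map_add, hTV.map_sub, hTV.map_smul] at rho_x rho_y ⊢
    linear_combination (norm := module) rho_x - rho_y
  · simp only [Phi2II, delta1II, partial1II, DT, thetaT, Phi1, trT, (htheta _ _).map_sub,
      DMap_sub hLYrep]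
    rw [← hTtr]
    have D_xy := DMap_reynolds hT hrep x y (f z)
    have theta_yz := hTVtheta y z (f x)
    have theta_xz := hTVtheta x z (f y)
    simp only [hf.map_add, hf.map_smul, hTV.map_add, hTV.map_sub, hTV.map_smul]
      at D_xy theta_yz theta_xz ⊢
    linear_combination (norm := module) D_xy + theta_yz - theta_xz
end
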